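/- Let G = G1 ×_I G2 be a discrete cusp with I ⊆ V2 nonempty and |V2| ≥ 2. Set M := (sup_{x∈V1} deg_{G1}(x)) · (max_{y∈V2} 1/m2(y)), let λ1 be the smallest eigenvalue of Δ_{G2,θ2} on ℓ²(V2,m2), and D := max_{y∈V2} deg_{G2}(y) > 0. Then for every finitely supported f : V1 × V2 → ℂ, (λ1/D)·(⟨f, deg_G(·) f⟩ − M·‖f‖²) ≤ Q_{G,θ}(f) ≤ 2M·‖f‖² + 2·⟨f, deg_G(·) f⟩, where ⟨f, deg_G(·) f⟩ = Σ_{(x,y)} m(x,y)·deg_G(x,y)·|f(x,y)|² and ‖f‖² = Σ_{(x,y)} m(x,y)|f(x,y)|². -/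

import Mathlib

open scoped BigOperators ENNReal

noncomputable section

namespace MagneticCusp

attribute [local instance] Classical.propDecidable

variable {V V1 V2 : Type*}

/-- The axioms of a weighted graph `(E, V, m)`: `E` is symmetric, non-negative,
with no loops, `m` is a positive weight, and the graph is locally finite. -/
def GraphAxioms (E : V → V → ℝ) (m : V → ℝ) : Prop :=
  (∀ x y, E x y = E y x) ∧ (∀ x y, 0 ≤ E x y) ∧ (∀ x, E x x = 0) ∧ (∀ x, 0 < m x) ∧
    ∀ x, {y | 0 < E x y}.Finite

/-- Connectedness of the graph with edge weight `E`. -/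
def Conn (E : V → V → ℝ) : Prop :=
  ∀ x y, Relation.ReflTransGen (fun a b => 0 < E a b) x y

/-- A (real representative of a) magnetic potential: antisymmetric, vanishing off edges. -/
def MagneticPotential (E θ : V → V → ℝ) : Prop :=
  (∀ x y, θ y x = -θ x y) ∧ ∀ x y, E x y = 0 → θ x y = 0

/-- `γ` is a cycle of length `N` in the graph with edge weight `E`. -/
def IsCycle (E : V → V → ℝ) (γ : ℕ → V) (N : ℕ) : Prop :=
  γ N = γ 0 ∧ ∀ i < N, 0 < E (γ i) (γ (i + 1))

/-- The holonomy (flux) of the magnetic potential `θ` along `γ` (a real representative;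
it is to be considered modulo `2π`). -/
def hol (θ : V → V → ℝ) (γ : ℕ → V) (N : ℕ) : ℝ :=
  ∑ i ∈ Finset.range N, θ (γ i) (γ (i + 1))

/-- `Hol_θ = 0`: every cycle has vanishing holonomy in `ℝ/2πℤ`. -/
def HolTrivial (E θ : V → V → ℝ) : Prop :=
  ∀ (γ : ℕ → V) (N : ℕ), IsCycle E γ N → ∃ k : ℤ, hol θ γ N = 2 * Real.pi * k

/-- The magnetic Laplacian `Δ_{G,θ}` acting on functions. -/
def lap (E : V → V → ℝ) (m : V → ℝ) (θ : V → V → ℝ) (f : V → ℂ) (x : V) : ℂ :=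
  ((m x : ℝ) : ℂ)⁻¹ *
    ∑' y, ((E x y : ℝ) : ℂ) * (f x - Complex.exp (((θ x y : ℝ) : ℂ) * Complex.I) * f y)

/-- The magnetic quadratic form `Q_{G,θ}`. -/
def quadForm (E θ : V → V → ℝ) (f : V → ℂ) : ℝ :=
  (1 / 2) * ∑' x, ∑' y, E x y * ‖f x - Complex.exp (((θ x y : ℝ) : ℂ) * Complex.I) * f y‖ ^ 2

/-- The degree `deg_G(x) = m(x)⁻¹ Σ_y E(x,y)`. -/
def degree (E : V → V → ℝ) (m : V → ℝ) (x : V) : ℝ := (m x)⁻¹ * ∑' y, E x y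

/-- The squared norm of `f` in `ℓ²(V,m)`. -/
def nrmSq (m : V → ℝ) (f : V → ℂ) : ℝ := ∑' x, m x * ‖f x‖ ^ 2

/-- Membership in `ℓ²(V,m)`. -/
def MemL2 (m : V → ℝ) (f : V → ℂ) : Prop := Summable fun x => m x * ‖f x‖ ^ 2

/-- The quadratic form `⟨f, deg_G(·) f⟩` of the multiplication operator by the degree. -/
def degForm (E : V → V → ℝ) (m : V → ℝ) (f : V → ℂ) : ℝ :=
  ∑' x, m x * degree E m x * ‖f x‖ ^ 2

/-- Weight of the product of two weighted graphs. -/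
def prodM (m1 : V1 → ℝ) (m2 : V2 → ℝ) : V1 × V2 → ℝ := fun p => m1 p.1 * m2 p.2

/-- Edge weight of the product of `G1` by `G2` through `I ⊆ V2`. -/
def prodE (E1 : V1 → V1 → ℝ) (E2 : V2 → V2 → ℝ) (I : Set V2) :
    V1 × V2 → V1 × V2 → ℝ := fun p q =>
  (if p.2 = q.2 ∧ p.2 ∈ I then E1 p.1 q.1 else 0) + (if p.1 = q.1 then E2 p.2 q.2 else 0)

/-- Edge weight of the Cartesian product of `G1` by `G2`. -/
def cartE (E1 : V1 → V1 → ℝ) (m1 : V1 → ℝ) (E2 : V2 → V2 → ℝ) (m2 : V2 → ℝ) :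
    V1 × V2 → V1 × V2 → ℝ := fun p q =>
  (if p.2 = q.2 then E1 p.1 q.1 * m2 p.2 else 0) + (if p.1 = q.1 then m1 p.1 * E2 p.2 q.2 else 0)

/-- Magnetic potential of the product of `G1` by `G2`. -/
def prodTheta (θ1 : V1 → V1 → ℝ) (θ2 : V2 → V2 → ℝ) : V1 × V2 → V1 × V2 → ℝ := fun p q =>
  (if p.2 = q.2 then θ1 p.1 q.1 else 0) + (if p.1 = q.1 then θ2 p.2 q.2 else 0)

/-- Hypothesis (H1): `m1(x) → 0` as `x → ∞` (on an infinite vertex set). -/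
def H1cond (m1 : V1 → ℝ) : Prop :=
  Infinite V1 ∧ ∀ ε : ℝ, 0 < ε → {x : V1 | ε ≤ m1 x}.Finite

/-- Hypothesis (H3): the degree of `G1` is bounded. -/
def H3cond (E1 : V1 → V1 → ℝ) (m1 : V1 → ℝ) : Prop :=
  ∃ d : ℝ, ∀ x, degree E1 m1 x ≤ d

/-- The quadratic form of the operator `m1⁻¹(·) ⊗ Δ_{G2,θ2}` on `ℓ²(V1 × V2, m1 ⊗ m2)`:
`⟨f, (m1⁻¹(·) ⊗ Δ_{G2,θ2}) f⟩ = Σ_x Q_{G2,θ2}(f(x,·))`. -/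
def fiberForm (E2 θ2 : V2 → V2 → ℝ) (f : V1 × V2 → ℂ) : ℝ :=
  ∑' x : V1, quadForm E2 θ2 fun y => f (x, y)

/-- A simple cycle: closed walk of length `≥ 3` with pairwise distinct vertices. -/
def IsSimpleCycle (E : V → V → ℝ) (γ : ℕ → V) (N : ℕ) : Prop :=
  3 ≤ N ∧ γ N = γ 0 ∧ (∀ i < N, 0 < E (γ i) (γ (i + 1))) ∧
    ∀ i < N, ∀ j < N, γ i = γ j → i = j

/-- The weighted length of an edge, `L_G(x,y) = sqrt(min(m x, m y)/E x y)`. -/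
def edgeLength (E : V → V → ℝ) (m : V → ℝ) (x y : V) : ℝ :=
  Real.sqrt (min (m x) (m y) / E x y)

/-- The weighted length of a cycle. -/
def cycleLength (E : V → V → ℝ) (m : V → ℝ) (γ : ℕ → V) (N : ℕ) : ℝ :=
  ∑ i ∈ Finset.range N, edgeLength E m (γ i) (γ (i + 1))

/-- The (weighted) girth: infimum of the weighted lengths of simple cycles (`∞` if none). -/
def girth (E : V → V → ℝ) (m : V → ℝ) : ℝ≥0∞ :=
  ⨅ c : {c : (ℕ → V) × ℕ // IsSimpleCycle E c.1 c.2},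
    ENNReal.ofReal (cycleLength E m c.1.1 c.1.2)

/-- The radius of injectivity: half the girth. -/
def injRad (E : V → V → ℝ) (m : V → ℝ) : ℝ≥0∞ := girth E m / 2

/-- Min-max encoding: there is an `n`-dimensional subspace of finitely supported
functions (the form core) on which `Q ≤ lam ‖·‖²_{ℓ²(V,m)}`.  For the self-adjoint
operator associated to the form `Q` with form core `C_c(V)` this says
`N_lam(H) = dim ran 1_{(-∞,lam]}(H) ≥ n`. -/
def DimGE (Q : (V → ℂ) → ℝ) (m : V → ℝ) (lam : ℝ) (n : ℕ) : Prop :=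
  ∃ g : Fin n → V → ℂ, LinearIndependent ℂ g ∧
    (∀ i, (Function.support (g i)).Finite) ∧
    ∀ f ∈ Submodule.span ℂ (Set.range g), Q f ≤ lam * nrmSq m f

/-- Compact resolvent (equivalently: empty essential spectrum) of the non-negative
self-adjoint operator associated to the form `Q`, encoded via min-max:
`N_lam(H) < ∞` for every `lam`. -/
def CompactResolvent (Q : (V → ℂ) → ℝ) (m : V → ℝ) : Prop :=
  ∀ lam : ℝ, ∃ n : ℕ, ∀ k : ℕ, DimGE Q m lam k → k ≤ n

/-- The eigenvalue counting function `N_lam(H) = dim ran 1_{(-∞,lam]}(H)`,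
encoded via min-max over the form core. -/
def countEig (Q : (V → ℂ) → ℝ) (m : V → ℝ) (lam : ℝ) : ℕ :=
  sSup {k : ℕ | DimGE Q m lam k}

/-- The `n`-th eigenvalue (counted with multiplicity, `n` starting at `0`) of the
self-adjoint operator associated to `Q`, via the Courant min-max principle. -/
def eigVal (Q : (V → ℂ) → ℝ) (m : V → ℝ) (n : ℕ) : ℝ :=
  sInf {t : ℝ | DimGE Q m t (n + 1)}

/-- Equality of the form domains of the two non-negative forms `Q1`, `Q2`, both with
form core the finitely supported functions: by the closed graph theorem this is
equivalent to the equivalence of the form norms on the common core. -/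
def SameFormDomain (Q1 Q2 : (V → ℂ) → ℝ) (m : V → ℝ) : Prop :=
  ∃ c1 c2 : ℝ, 0 < c1 ∧ 0 < c2 ∧ ∀ f : V → ℂ, (Function.support f).Finite →
    c1 * (nrmSq m f + Q1 f) ≤ nrmSq m f + Q2 f ∧
      nrmSq m f + Q2 f ≤ c2 * (nrmSq m f + Q1 f)


open scoped ComplexOrder in
/-- A Hermitian matrix `H` on `ℓ²(n, m)` whose generalized real eigenvalues `s`
(`H g = s m g`) are all at least `t` is bounded below by `t` as a form. -/
theorem mul_nrmSq_le_re_dotProduct_mulVec {n : Type*} [Fintype n] {H : Matrix n n ℂ}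
    (hH : H.IsHermitian) {m : n → ℝ} (hm : ∀ y, 0 < m y) {t : ℝ}
    (ht : ∀ (s : ℝ) (g : n → ℂ), g ≠ 0 →
      (∀ y, H.mulVec g y = ((s * m y : ℝ) : ℂ) * g y) → t ≤ s) (g : n → ℂ) :
    t * nrmSq m g ≤ (star g ⬝ᵥ H.mulVec g).re := by
  set w : n → ℝ := fun y => (Real.sqrt (m y))⁻¹ with hw
  have hw0 : ∀ y, 0 < w y := fun y => inv_pos.2 (Real.sqrt_pos.2 (hm y))
  have hwm : ∀ y, w y * w y * m y = 1 := fun y => by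
    have h1 := Real.mul_self_sqrt (hm y).le
    have h2 := (Real.sqrt_pos.2 (hm y)).ne'
    simp only [hw]
    field_simp
    nlinarith
  set B : Matrix n n ℂ := Matrix.of fun y z =>
    (w y : ℂ) * H y z * (w z : ℂ) - if y = z then (t : ℂ) else 0 with hB
  have hBmul : ∀ (v : n → ℂ) (y : n), B.mulVec v y =
      (w y : ℂ) * H.mulVec (fun z => (w z : ℂ) * v z) y - t * v y := by
    intro v y
    simp [Matrix.mulVec, dotProduct, hB, sub_mul, Finset.sum_sub_distrib, Finset.mul_sum,
      mul_assoc]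
  have hBH : B.IsHermitian := by
    ext y z
    have := hH.apply y z
    simp only [Matrix.conjTranspose_apply, hB, Matrix.of_apply, star_sub, star_mul', this]
    by_cases h : y = z
    · subst h; simp [mul_comm, mul_left_comm]
    · simp [h, Ne.symm h]; ring
  have hpos : B.PosSemidef := by
    rw [hBH.posSemidef_iff_eigenvalues_nonneg]
    intro j
    have hev := hBH.mulVec_eigenvectorBasis j
    set v : n → ℂ := (hBH.eigenvectorBasis j).ofLp with hv
    have hv0 : v ≠ 0 := fun h0 =>
      hBH.eigenvectorBasis.orthonormal.ne_zero j (WithLp.ofLp_injective 2 (h0.trans rfl))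
    have key := ht (t + hBH.eigenvalues j) (fun z => (w z : ℂ) * v z) ?_ ?_
    · simpa using key
    · contrapose! hv0
      ext z
      have := congrFun hv0 z
      simpa [(hw0 z).ne'] using this
    · intro y
      have h1 := congrFun hev y
      rw [hBmul] at h1
      have h2 : ((w y : ℂ)) * w y * m y = 1 := by exact_mod_cast hwm y
      have h3 : (w y : ℂ) ≠ 0 := by exact_mod_cast (hw0 y).ne'
      apply mul_left_cancel₀ h3
      simp only [Pi.smul_apply, Complex.real_smul] at h1
      push_cast
      linear_combination h1 - (t + hBH.eigenvalues j) * v y * h2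
  have hq := hpos.re_dotProduct_nonneg (fun y => ((w y)⁻¹ : ℂ) * g y)
  have hwg : (fun z => (w z : ℂ) * (((w z)⁻¹ : ℂ) * g z)) = g := by
    ext z
    have h3 : (w z : ℂ) ≠ 0 := by exact_mod_cast (hw0 z).ne'
    field_simp
  have heq : star (fun y => ((w y)⁻¹ : ℂ) * g y) ⬝ᵥ B.mulVec (fun y => ((w y)⁻¹ : ℂ) * g y) =
      star g ⬝ᵥ H.mulVec g - ((t * nrmSq m g : ℝ) : ℂ) := by
    simp only [dotProduct, hBmul, hwg, nrmSq, tsum_fintype, Complex.ofReal_mul,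
      Complex.ofReal_sum, Finset.mul_sum, ← Finset.sum_sub_distrib]
    refine Finset.sum_congr rfl fun y _ => ?_
    have h2 : ((w y : ℂ)) * w y * m y = 1 := by exact_mod_cast hwm y
    have h3 : (w y : ℂ) ≠ 0 := by exact_mod_cast (hw0 y).ne'
    have h4 : ((‖g y‖ ^ 2 : ℝ) : ℂ) = star (g y) * g y := by
      rw [Complex.ofReal_pow]; exact (Complex.conj_mul' _).symm
    rw [h4]
    simp only [Pi.star_apply, star_mul', star_inv₀]
    have h5 : star (w y : ℂ) = w y := Complex.conj_ofReal _
    rw [h5]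
    field_simp
    linear_combination (t * star (g y) * g y) * h2
  rw [heq] at hq
  simpa using hq

/-- The matrix of the (unweighted) magnetic Laplacian `m Δ_{G,θ}` of a finite graph. -/
def lapMatrix [Fintype V] (E θ : V → V → ℝ) : Matrix V V ℂ :=
  Matrix.of fun x y => (if x = y then ((∑ z, E x z : ℝ) : ℂ) else 0) -
    (E x y : ℂ) * Complex.exp ((θ x y : ℂ) * Complex.I)

theorem lapMatrix_mulVec [Fintype V] (E θ : V → V → ℝ) (g : V → ℂ) (x : V) :
    (lapMatrix E θ).mulVec g x =
      ∑ y, (E x y : ℂ) * (g x - Complex.exp ((θ x y : ℂ) * Complex.I) * g y) := by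
  simp [lapMatrix, Matrix.mulVec, dotProduct, sub_mul, mul_sub, Finset.sum_sub_distrib,
    Finset.sum_mul, mul_assoc]

theorem star_exp_ofReal_mul_I (a : ℝ) :
    star (Complex.exp ((a : ℂ) * Complex.I)) = Complex.exp (((-a : ℝ) : ℂ) * Complex.I) := by
  rw [← starRingEnd_apply, ← Complex.exp_conj]
  simp

theorem isHermitian_lapMatrix [Fintype V] {E θ : V → V → ℝ} (hE : ∀ x y, E x y = E y x)
    (hθ : ∀ x y, θ y x = -θ x y) : (lapMatrix E θ).IsHermitian := by
  ext x y
  simp only [Matrix.conjTranspose_apply, lapMatrix, Matrix.of_apply, star_sub, star_mul',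
    star_exp_ofReal_mul_I, hθ x y, neg_neg, hE y x]
  by_cases h : x = y
  · subst h; simp [Complex.conj_ofReal]
  · simp [h, Ne.symm h, Complex.conj_ofReal]

/-- Green's formula on a finite magnetic graph. -/
theorem re_star_dotProduct_lapMatrix_mulVec [Fintype V] {E θ : V → V → ℝ}
    (hE : ∀ x y, E x y = E y x) (hθ : ∀ x y, θ y x = -θ x y) (g : V → ℂ) :
    (star g ⬝ᵥ (lapMatrix E θ).mulVec g).re = quadForm E θ g := by
  set T : V → V → ℝ := fun x y =>
    (star (g x) * ((E x y : ℂ) * (g x - Complex.exp ((θ x y : ℂ) * Complex.I) * g y))).re with hT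
  have h1 : (star g ⬝ᵥ (lapMatrix E θ).mulVec g).re = ∑ x, ∑ y, T x y := by
    simp only [dotProduct, lapMatrix_mulVec, Finset.mul_sum, Complex.re_sum, hT, Pi.star_apply]
  have h2 : ∀ x y, E x y * ‖g x - Complex.exp ((θ x y : ℂ) * Complex.I) * g y‖ ^ 2 =
      T x y + T y x := by
    intro x y
    have hu := Complex.norm_exp_ofReal_mul_I (θ x y)
    simp only [hT, hθ x y, hE y x, ← star_exp_ofReal_mul_I]
    set u := Complex.exp ((θ x y : ℂ) * Complex.I)
    have hu2 : u.re * u.re + u.im * u.im = 1 := by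
      rw [← Complex.normSq_apply, Complex.normSq_eq_norm_sq, hu]; norm_num
    rw [← Complex.normSq_eq_norm_sq, Complex.normSq_apply]
    simp only [Complex.star_def, Complex.mul_re, Complex.mul_im, Complex.sub_re, Complex.sub_im,
      Complex.conj_re, Complex.conj_im, Complex.ofReal_re, Complex.ofReal_im]
    linear_combination (E x y * ((g y).re ^ 2 + (g y).im ^ 2)) * hu2
  have h3 : ∑ x, ∑ y, T y x = ∑ x, ∑ y, T x y := Finset.sum_comm
  rw [h1]
  simp only [quadForm, tsum_fintype, h2, Finset.sum_add_distrib, h3]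
  ring

theorem lap_eq_iff [Fintype V] {E θ : V → V → ℝ} {m : V → ℝ} (hm : ∀ x, 0 < m x) (s : ℝ)
    (g : V → ℂ) (x : V) :
    lap E m θ g x = (s : ℂ) * g x ↔
      (lapMatrix E θ).mulVec g x = ((s * m x : ℝ) : ℂ) * g x := by
  have h : (m x : ℂ) ≠ 0 := by exact_mod_cast (hm x).ne'
  rw [lapMatrix_mulVec, lap, tsum_fintype, inv_mul_eq_iff_eq_mul₀ h]
  push_cast
  ring_nf

theorem quadForm_nonneg {E θ : V → V → ℝ} (hE : ∀ x y, 0 ≤ E x y) (f : V → ℂ) :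
    0 ≤ quadForm E θ f :=
  mul_nonneg (by norm_num) (tsum_nonneg fun x => tsum_nonneg fun y =>
    mul_nonneg (hE x y) (sq_nonneg _))

theorem mul_nrmSq_le_quadForm [Fintype V] {E θ : V → V → ℝ} {m : V → ℝ}
    (hG : GraphAxioms E m) (hθ : MagneticPotential E θ) {t : ℝ}
    (ht : t ∈ lowerBounds {s : ℝ | ∃ g : V → ℂ, g ≠ 0 ∧ ∀ y, lap E m θ g y = (s : ℂ) * g y})
    (g : V → ℂ) : t * nrmSq m g ≤ quadForm E θ g := by
  obtain ⟨hsymm, -, -, hm, -⟩ := hG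
  rw [← re_star_dotProduct_lapMatrix_mulVec hsymm hθ.1]
  exact mul_nrmSq_le_re_dotProduct_mulVec (isHermitian_lapMatrix hsymm hθ.1) hm
    (fun s g hg h => ht ⟨g, hg, fun y => (lap_eq_iff hm s g y).2 (h y)⟩) g

theorem eigenvalue_nonneg [Fintype V] {E θ : V → V → ℝ} {m : V → ℝ}
    (hG : GraphAxioms E m) (hθ : MagneticPotential E θ) {s : ℝ} {g : V → ℂ} (hg : g ≠ 0)
    (h : ∀ y, lap E m θ g y = (s : ℂ) * g y) : 0 ≤ s := by
  obtain ⟨hsymm, hE, -, hm, -⟩ := hG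
  have hQ := quadForm_nonneg (θ := θ) hE g
  have hN : 0 < nrmSq m g := by
    obtain ⟨x, hx⟩ := Function.ne_iff.1 hg
    rw [nrmSq, tsum_fintype]
    refine Finset.sum_pos' (fun y _ => mul_nonneg (hm y).le (sq_nonneg _))
      ⟨x, Finset.mem_univ x, mul_pos (hm x) (pow_pos (norm_pos_iff.2 hx) 2)⟩
  have key : quadForm E θ g = s * nrmSq m g := by
    rw [← re_star_dotProduct_lapMatrix_mulVec hsymm hθ.1]
    simp only [dotProduct, fun y => (lap_eq_iff hm s g y).1 (h y), nrmSq, tsum_fintype,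
      Finset.mul_sum, Complex.re_sum]
    refine Finset.sum_congr rfl fun y _ => ?_
    rw [← Complex.normSq_eq_norm_sq, Complex.normSq_apply]
    simp only [Pi.star_apply, Complex.star_def, Complex.mul_re, Complex.mul_im, Complex.conj_re,
      Complex.conj_im, Complex.ofReal_re, Complex.ofReal_im]
    ring
  rw [key] at hQ
  exact nonneg_of_mul_nonneg_left hQ hN

theorem summable_of_eq_zero_of_eq_zero {f : V → ℂ} (hf : (Function.support f).Finite)
    {c : V → ℝ} (hc : ∀ x, f x = 0 → c x = 0) : Summable c :=
  summable_of_hasFiniteSupport (hf.subset fun x hx h0 => hx (hc x h0))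

theorem finite_support_edge {E : V → V → ℝ} {m : V → ℝ} (hG : GraphAxioms E m) (x : V) :
    (Function.support (E x)).Finite :=
  (hG.2.2.2.2 x).subset fun y hy => lt_of_le_of_ne (hG.2.1 x y) (Ne.symm hy)

theorem summable_edge_mul_norm_sq {E : V → V → ℝ} (hE : ∀ x, (Function.support (E x)).Finite)
    {f : V → ℂ} (hf : (Function.support f).Finite) :
    Summable fun p : V × V => E p.1 p.2 * ‖f p.1‖ ^ 2 := by
  refine summable_of_hasFiniteSupport ((hf.biUnion fun x _ =>
    (hE x).image fun y => (x, y)).subset ?_)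
  rintro ⟨x, y⟩ h
  simp only [Function.mem_support, ne_eq, mul_eq_zero, not_or] at h
  simp only [Set.mem_iUnion, Set.mem_image, Function.mem_support]
  exact ⟨x, fun h0 => h.2 (by simp [h0]), y, h.1, rfl⟩

theorem edge_mul_norm_sub_sq_le {E θ : V → V → ℝ} (hE : ∀ x y, 0 ≤ E x y) (f : V → ℂ) (x y : V) :
    E x y * ‖f x - Complex.exp ((θ x y : ℂ) * Complex.I) * f y‖ ^ 2 ≤
      2 * (E x y * ‖f x‖ ^ 2) + 2 * (E x y * ‖f y‖ ^ 2) := by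
  have h := norm_sub_le (f x) (Complex.exp ((θ x y : ℂ) * Complex.I) * f y)
  rw [norm_mul, Complex.norm_exp_ofReal_mul_I, one_mul] at h
  have h2 : ‖f x - Complex.exp ((θ x y : ℂ) * Complex.I) * f y‖ ^ 2 ≤
      2 * ‖f x‖ ^ 2 + 2 * ‖f y‖ ^ 2 := by
    nlinarith [pow_le_pow_left₀ (norm_nonneg _) h 2, sq_nonneg (‖f x‖ - ‖f y‖)]
  nlinarith [mul_le_mul_of_nonneg_left h2 (hE x y)]

theorem summable_edge_mul_norm_sq_snd {E : V → V → ℝ} (hsymm : ∀ x y, E x y = E y x)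
    (hfin : ∀ x, (Function.support (E x)).Finite) {f : V → ℂ}
    (hf : (Function.support f).Finite) :
    Summable fun p : V × V => E p.1 p.2 * ‖f p.2‖ ^ 2 := by
  refine ((Equiv.prodComm V V).summable_iff.2 (summable_edge_mul_norm_sq hfin hf)).congr
    fun p => ?_
  simp [hsymm p.1 p.2]

theorem summable_quadForm {E : V → V → ℝ} (θ : V → V → ℝ) (hsymm : ∀ x y, E x y = E y x)
    (hE : ∀ x y, 0 ≤ E x y) (hfin : ∀ x, (Function.support (E x)).Finite) {f : V → ℂ}
    (hf : (Function.support f).Finite) :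
    Summable fun p : V × V =>
      E p.1 p.2 * ‖f p.1 - Complex.exp ((θ p.1 p.2 : ℂ) * Complex.I) * f p.2‖ ^ 2 :=
  Summable.of_nonneg_of_le (fun _ => mul_nonneg (hE _ _) (sq_nonneg _))
    (fun p => edge_mul_norm_sub_sq_le hE f p.1 p.2)
    (((summable_edge_mul_norm_sq hfin hf).mul_left 2).add
      ((summable_edge_mul_norm_sq_snd hsymm hfin hf).mul_left 2))

theorem quadForm_eq_tsum_prod {E : V → V → ℝ} (θ : V → V → ℝ) (hsymm : ∀ x y, E x y = E y x)
    (hE : ∀ x y, 0 ≤ E x y) (hfin : ∀ x, (Function.support (E x)).Finite) {f : V → ℂ}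
    (hf : (Function.support f).Finite) :
    quadForm E θ f = (1 / 2) * ∑' p : V × V,
      E p.1 p.2 * ‖f p.1 - Complex.exp ((θ p.1 p.2 : ℂ) * Complex.I) * f p.2‖ ^ 2 := by
  rw [quadForm, (summable_quadForm θ hsymm hE hfin hf).tsum_prod]

theorem quadForm_le_two_mul_degForm {E : V → V → ℝ} (θ : V → V → ℝ) {m : V → ℝ}
    (hsymm : ∀ x y, E x y = E y x) (hE : ∀ x y, 0 ≤ E x y) (hm : ∀ x, 0 < m x)
    (hfin : ∀ x, (Function.support (E x)).Finite) {f : V → ℂ}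
    (hf : (Function.support f).Finite) :
    quadForm E θ f ≤ 2 * degForm E m f := by
  have h1 := summable_edge_mul_norm_sq hfin hf
  have h2 := summable_edge_mul_norm_sq_snd hsymm hfin hf
  have hd : degForm E m f = ∑' p : V × V, E p.1 p.2 * ‖f p.1‖ ^ 2 := by
    rw [h1.tsum_prod, degForm]
    refine tsum_congr fun x => ?_
    dsimp only
    rw [tsum_mul_right, degree, mul_inv_cancel_left₀ (hm x).ne']
  have hd' : ∑' p : V × V, E p.1 p.2 * ‖f p.2‖ ^ 2 = degForm E m f := by
    rw [hd, ← (Equiv.prodComm V V).tsum_eq fun p : V × V => E p.1 p.2 * ‖f p.1‖ ^ 2]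
    exact tsum_congr fun p => by simp [hsymm p.1 p.2]
  have h3 : ∑' p : V × V,
        E p.1 p.2 * ‖f p.1 - Complex.exp ((θ p.1 p.2 : ℂ) * Complex.I) * f p.2‖ ^ 2 ≤
      ∑' p : V × V, (2 * (E p.1 p.2 * ‖f p.1‖ ^ 2) + 2 * (E p.1 p.2 * ‖f p.2‖ ^ 2)) :=
    (summable_quadForm θ hsymm hE hfin hf).tsum_le_tsum
      (fun p => edge_mul_norm_sub_sq_le hE f p.1 p.2) ((h1.mul_left 2).add (h2.mul_left 2))
  rw [(h1.mul_left 2).tsum_add (h2.mul_left 2), tsum_mul_left, tsum_mul_left, hd', ← hd] at h3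
  rw [quadForm_eq_tsum_prod θ hsymm hE hfin hf]
  linarith

theorem prodE_symm {E1 : V1 → V1 → ℝ} {E2 : V2 → V2 → ℝ} (h1 : ∀ x y, E1 x y = E1 y x)
    (h2 : ∀ x y, E2 x y = E2 y x) (I : Set V2) (p q : V1 × V2) :
    prodE E1 E2 I p q = prodE E1 E2 I q p := by
  obtain ⟨x, y⟩ := p
  obtain ⟨x', y'⟩ := q
  simp only [prodE, h1 x' x, h2 y' y, eq_comm (a := x') (b := x)]
  by_cases h : y = y'
  · subst h; rfl
  · simp [h, Ne.symm h]

theorem prodE_nonneg {E1 : V1 → V1 → ℝ} {E2 : V2 → V2 → ℝ} (h1 : ∀ x y, 0 ≤ E1 x y)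
    (h2 : ∀ x y, 0 ≤ E2 x y) (I : Set V2) (p q : V1 × V2) : 0 ≤ prodE E1 E2 I p q := by
  unfold prodE
  refine add_nonneg ?_ ?_ <;> split_ifs <;> simp [h1, h2]

theorem hasSum_prodE [Fintype V2] {E1 : V1 → V1 → ℝ}
    (hfin : ∀ x, (Function.support (E1 x)).Finite) (E2 : V2 → V2 → ℝ) (I : Set V2)
    (p : V1 × V2) :
    HasSum (prodE E1 E2 I p)
      ((if p.2 ∈ I then ∑' x, E1 p.1 x else 0) + ∑' y, E2 p.2 y) := by
  refine HasSum.add ?_ ?_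
  · by_cases hp : p.2 ∈ I
    · have hs : HasSum (E1 p.1) (∑' x, E1 p.1 x) :=
        (summable_of_hasFiniteSupport (hfin p.1)).hasSum
      have hi : Function.Injective fun x : V1 => (x, p.2) := fun a b h => (Prod.mk.inj h).1
      simp only [hp, and_true, if_true]
      refine (hi.hasSum_iff ?_).1 (by simpa [Function.comp_def] using hs)
      rintro ⟨x, y⟩ h
      exact if_neg fun h' => h ⟨x, Prod.ext rfl h'⟩
    · simp [hp, hasSum_zero]
  · have hs : HasSum (E2 p.2) (∑' y, E2 p.2 y) := Summable.of_finite.hasSum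
    have hi : Function.Injective fun y : V2 => (p.1, y) := fun a b h => (Prod.mk.inj h).2
    refine (hi.hasSum_iff ?_).1 (by simpa [Function.comp_def] using hs)
    rintro ⟨x, y⟩ h
    exact if_neg fun h' => h ⟨y, Prod.ext h' rfl⟩

theorem finite_support_prodE [Fintype V2] {E1 : V1 → V1 → ℝ}
    (hfin : ∀ x, (Function.support (E1 x)).Finite) (E2 : V2 → V2 → ℝ) (I : Set V2)
    (p : V1 × V2) : (Function.support (prodE E1 E2 I p)).Finite := by
  refine (((hfin p.1).union (Set.finite_singleton p.1)).prod
    (Set.finite_univ (α := V2))).subset ?_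
  rintro ⟨x, y⟩ h
  simp only [Set.mem_prod, Set.mem_union, Function.mem_support, Set.mem_singleton_iff,
    Set.mem_univ, and_true]
  by_contra! hc
  exact h (by simp [prodE, hc.1, Ne.symm hc.2])

theorem fiberForm_le_quadForm [Fintype V2] {E1 : V1 → V1 → ℝ} {m1 : V1 → ℝ}
    {θ1 : V1 → V1 → ℝ} {E2 : V2 → V2 → ℝ} {m2 : V2 → ℝ} (θ2 : V2 → V2 → ℝ) (I : Set V2)
    (hG1 : GraphAxioms E1 m1) (hG2 : GraphAxioms E2 m2) (hθ1 : MagneticPotential E1 θ1)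
    {f : V1 × V2 → ℂ} (hf : (Function.support f).Finite) :
    (Summable fun x => quadForm E2 θ2 fun y => f (x, y)) ∧
      fiberForm E2 θ2 f ≤ quadForm (prodE E1 E2 I) (prodTheta θ1 θ2) f := by
  have hsymm := prodE_symm hG1.1 hG2.1 I
  have hE := prodE_nonneg hG1.2.1 hG2.2.1 I
  have hfin := finite_support_prodE (finite_support_edge hG1) E2 I
  have hS := summable_quadForm (prodTheta θ1 θ2) hsymm hE hfin hf
  rw [quadForm_eq_tsum_prod _ hsymm hE hfin hf]
  set F : (V1 × V2) × (V1 × V2) → ℝ := fun p => prodE E1 E2 I p.1 p.2 *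
    ‖f p.1 - Complex.exp ((prodTheta θ1 θ2 p.1 p.2 : ℂ) * Complex.I) * f p.2‖ ^ 2 with hF
  let i : V1 × (V2 × V2) → (V1 × V2) × (V1 × V2) := fun a => ((a.1, a.2.1), (a.1, a.2.2))
  have hi : Function.Injective i := by
    rintro ⟨x, y, z⟩ ⟨x', y', z'⟩ h
    simp only [i, Prod.mk.injEq] at h ⊢
    tauto
  have hFi : ∀ x y z, F (i (x, (y, z))) =
      E2 y z * ‖f (x, y) - Complex.exp ((θ2 y z : ℂ) * Complex.I) * f (x, z)‖ ^ 2 := by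
    intro x y z
    simp [hF, i, prodE, prodTheta, hG1.2.2.1 x, hθ1.2 x x (hG1.2.2.1 x)]
  have hSi : Summable (F ∘ i) := hS.comp_injective hi
  have hfib : ∀ x, (quadForm E2 θ2 fun y => f (x, y)) =
      (1 / 2) * ∑' c : V2 × V2, (F ∘ i) (x, c) := by
    intro x
    rw [quadForm, tsum_fintype, tsum_fintype, Fintype.sum_prod_type]
    simp only [tsum_fintype, Function.comp_apply, hFi]
  have hle := tsum_comp_le_tsum_of_inj hS (fun p => mul_nonneg (hE _ _) (sq_nonneg _)) hi
  refine ⟨?_, ?_⟩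
  · simp only [hfib]
    exact hSi.prod.mul_left _
  · simp only [fiberForm, hfib, tsum_mul_left]
    rw [← hSi.tsum_prod]
    exact mul_le_mul_of_nonneg_left hle (by norm_num)

theorem degree_nonneg {E : V → V → ℝ} {m : V → ℝ} (hG : GraphAxioms E m) (x : V) :
    0 ≤ degree E m x :=
  mul_nonneg (inv_pos.2 (hG.2.2.2.1 x)).le (tsum_nonneg (hG.2.1 x))

theorem iSup_degree_pos [Fintype V] {E : V → V → ℝ} {m : V → ℝ} (hG : GraphAxioms E m)
    (hconn : Conn E) (hcard : 2 ≤ Fintype.card V) : 0 < ⨆ x, degree E m x := by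
  obtain ⟨a, b, hab⟩ := Fintype.one_lt_card_iff.1 hcard
  obtain h | ⟨c, hc, -⟩ := (hconn a b).cases_head
  · exact absurd h hab
  have hpos : 0 < degree E m a := by
    refine mul_pos (inv_pos.2 (hG.2.2.2.1 a)) ?_
    rw [tsum_fintype]
    exact Finset.sum_pos' (fun y _ => hG.2.1 a y) ⟨c, Finset.mem_univ c, hc⟩
  exact hpos.trans_le (le_ciSup (f := degree E m) (Set.finite_range _).bddAbove a)

theorem prodM_mul_degree_prodE [Fintype V2] {E1 : V1 → V1 → ℝ} {m1 : V1 → ℝ}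
    {E2 : V2 → V2 → ℝ} {m2 : V2 → ℝ} (hG1 : GraphAxioms E1 m1) (hG2 : GraphAxioms E2 m2)
    (I : Set V2) (p : V1 × V2) :
    prodM m1 m2 p * degree (prodE E1 E2 I) (prodM m1 m2) p =
      (if p.2 ∈ I then m1 p.1 * degree E1 m1 p.1 else 0) + m2 p.2 * degree E2 m2 p.2 := by
  have h1 := hG1.2.2.2.1 p.1
  have h2 := hG2.2.2.2.1 p.2
  have h : prodM m1 m2 p ≠ 0 := (mul_pos h1 h2).ne'
  rw [degree, mul_inv_cancel_left₀ h, (hasSum_prodE (finite_support_edge hG1) E2 I p).tsum_eq,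
    degree, degree, mul_inv_cancel_left₀ h1.ne', mul_inv_cancel_left₀ h2.ne']

theorem degForm_sub_le [Fintype V2] {E1 : V1 → V1 → ℝ} {m1 : V1 → ℝ}
    {E2 : V2 → V2 → ℝ} {m2 : V2 → ℝ} (hG1 : GraphAxioms E1 m1) (hG2 : GraphAxioms E2 m2)
    (hH3 : H3cond E1 m1) (I : Set V2) {f : V1 × V2 → ℂ} (hf : (Function.support f).Finite) :
    degForm (prodE E1 E2 I) (prodM m1 m2) f -
        ((⨆ x, degree E1 m1 x) * ⨆ y, (m2 y)⁻¹) * nrmSq (prodM m1 m2) f ≤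
      (⨆ y, degree E2 m2 y) * ∑' p : V1 × V2, m2 p.2 * ‖f p‖ ^ 2 := by
  have hs {c : V1 × V2 → ℝ} : Summable fun p => c p * ‖f p‖ ^ 2 :=
    summable_of_eq_zero_of_eq_zero hf fun _ hp => by simp [hp]
  rw [degForm, nrmSq, ← tsum_mul_left, ← tsum_mul_left, ← hs.tsum_sub (hs.mul_left _)]
  refine (hs.sub (hs.mul_left _)).tsum_le_tsum (fun p => ?_) (hs.mul_left _)
  have h1 := hG1.2.2.2.1 p.1
  have h2 := hG2.2.2.2.1 p.2
  obtain ⟨d, hd⟩ := hH3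
  have hd1 : degree E1 m1 p.1 ≤ ⨆ x, degree E1 m1 x :=
    le_ciSup (f := degree E1 m1) ⟨d, Set.forall_mem_range.2 hd⟩ p.1
  have hd2 : degree E2 m2 p.2 ≤ ⨆ y, degree E2 m2 y :=
    le_ciSup (f := degree E2 m2) (Set.finite_range _).bddAbove p.2
  have hm : (m2 p.2)⁻¹ ≤ ⨆ y, (m2 y)⁻¹ :=
    le_ciSup (f := fun y => (m2 y)⁻¹) (Set.finite_range _).bddAbove p.2
  have h0 := degree_nonneg hG1 p.1
  have hm1 : 1 ≤ (⨆ y, (m2 y)⁻¹) * m2 p.2 := by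
    simpa [h2.ne'] using mul_le_mul_of_nonneg_right hm h2.le
  have hkey : degree E1 m1 p.1 ≤ (⨆ x, degree E1 m1 x) * ((⨆ y, (m2 y)⁻¹) * m2 p.2) :=
    hd1.trans (le_mul_of_one_le_right (h0.trans hd1) hm1)
  have hif : (if p.2 ∈ I then m1 p.1 * degree E1 m1 p.1 else 0) ≤ m1 p.1 * degree E1 m1 p.1 := by
    split_ifs
    · exact le_rfl
    · exact mul_nonneg h1.le h0
  rw [prodM_mul_degree_prodE hG1 hG2, ← mul_assoc, ← sub_mul, ← mul_assoc]
  refine mul_le_mul_of_nonneg_right ?_ (sq_nonneg _)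
  rw [prodM]
  nlinarith [mul_le_mul_of_nonneg_left hkey h1.le, mul_le_mul_of_nonneg_left hd2 h2.le]

/-- For a discrete cusp `G = G1 ×_I G2` with `|V2| ≥ 2`, `λ1` the
smallest eigenvalue of `Δ_{G2,θ2}` and `D = max deg_{G2} > 0`:
`(λ1/D)(⟨f, deg_G f⟩ - M‖f‖²) ≤ Q_{G,θ}(f) ≤ 2M‖f‖² + 2⟨f, deg_G f⟩` for finitely
supported `f`. -/
theorem form_comparison_with_degree
    [Fintype V2]
    (E1 : V1 → V1 → ℝ) (m1 : V1 → ℝ) (θ1 : V1 → V1 → ℝ)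
    (E2 : V2 → V2 → ℝ) (m2 : V2 → ℝ) (θ2 : V2 → V2 → ℝ)
    (I : Set V2) (hI : I.Nonempty) (hcard : 2 ≤ Fintype.card V2)
    (hG1 : GraphAxioms E1 m1) (hG2 : GraphAxioms E2 m2)
    (hθ1 : MagneticPotential E1 θ1) (hθ2 : MagneticPotential E2 θ2)
    (hconn1 : Conn E1) (hconn2 : Conn E2)
    (hH1 : H1cond m1) (hH3 : H3cond E1 m1)
    (M : ℝ) (hM : M = (⨆ x, degree E1 m1 x) * ⨆ y, (m2 y)⁻¹)
    (lam1 : ℝ)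
    (hlam1 : IsLeast {t : ℝ | ∃ g : V2 → ℂ, g ≠ 0 ∧
      ∀ y, lap E2 m2 θ2 g y = (t : ℂ) * g y} lam1)
    (D : ℝ) (hD : D = ⨆ y, degree E2 m2 y) :
    0 < D ∧
      ∀ f : V1 × V2 → ℂ, (Function.support f).Finite →
        lam1 / D *
            (degForm (prodE E1 E2 I) (prodM m1 m2) f - M * nrmSq (prodM m1 m2) f) ≤
            quadForm (prodE E1 E2 I) (prodTheta θ1 θ2) f ∧
          quadForm (prodE E1 E2 I) (prodTheta θ1 θ2) f ≤
            2 * M * nrmSq (prodM m1 m2) f +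
              2 * degForm (prodE E1 E2 I) (prodM m1 m2) f := by
  obtain ⟨⟨g, hg, hlap⟩, hlb⟩ := hlam1
  have hDpos : 0 < D := hD ▸ iSup_degree_pos hG2 hconn2 hcard
  have hlam : 0 ≤ lam1 := eigenvalue_nonneg hG2 hθ2 hg hlap
  refine ⟨hDpos, fun f hf => ⟨?_, ?_⟩⟩
  · obtain ⟨hS, hQ⟩ := fiberForm_le_quadForm θ2 I hG1 hG2 hθ1 hf
    have hs : Summable fun p : V1 × V2 => m2 p.2 * ‖f p‖ ^ 2 :=
      summable_of_eq_zero_of_eq_zero hf fun p hp => by simp [hp]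
    have hfib : lam1 * ∑' p : V1 × V2, m2 p.2 * ‖f p‖ ^ 2 ≤ fiberForm E2 θ2 f := by
      rw [hs.tsum_prod, ← tsum_mul_left]
      exact (hs.prod.mul_left _).tsum_le_tsum
        (fun x => mul_nrmSq_le_quadForm hG2 hθ2 hlb fun y => f (x, y)) hS
    have hdeg := degForm_sub_le hG1 hG2 hH3 I hf
    rw [← hM, ← hD] at hdeg
    refine le_trans ?_ (hfib.trans hQ)
    refine (mul_le_mul_of_nonneg_left hdeg (div_nonneg hlam hDpos.le)).trans_eq ?_
    rw [← mul_assoc, div_mul_cancel₀ _ hDpos.ne']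
  · have hM0 : 0 ≤ M := hM ▸ mul_nonneg (Real.iSup_nonneg (degree_nonneg hG1))
      (Real.iSup_nonneg fun y => (inv_pos.2 (hG2.2.2.2.1 y)).le)
    have hm : ∀ p, 0 < prodM m1 m2 p := fun p => mul_pos (hG1.2.2.2.1 p.1) (hG2.2.2.2.1 p.2)
    have hN : 0 ≤ nrmSq (prodM m1 m2) f :=
      tsum_nonneg fun p => mul_nonneg (hm p).le (sq_nonneg _)
    have hQ := quadForm_le_two_mul_degForm (prodTheta θ1 θ2) (prodE_symm hG1.1 hG2.1 I)
      (prodE_nonneg hG1.2.1 hG2.2.1 I) hm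
      (finite_support_prodE (finite_support_edge hG1) E2 I) hf
    linarith [mul_nonneg hM0 hN]

end MagneticCusp
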